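/- Let V be a nonlocal vertex algebra and let W be a vector space equipped with a linear map Y_W from V to ℰ(W) with Y_W(1, x) = 1_W. Then (W, Y_W) is a V-module if and only if for every u, v ∈ V there exists a nonnegative integer k such that (x₁−x₂)^k Y_W(u,x₁) Y_W(v,x₂) ∈ Hom(W, W((x₁,x₂))) and Y_W(Y(u,x₀)v, x) = Y_ℰ(Y_W(u,x), x₀) Y_W(v,x). -/

import Mathlib

noncomputable section

open Classical

namespace NVA

/-! ### The space ℰ(W) = Hom(W, W((x))), coefficient-indexed by modes:
`a w n` is the mode `a_n` applied to `w`, where `a(x)w = ∑ (a_n w) x^{-n-1}`.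
Lower truncation of `a(x)w` in powers of `x` means `a_n w = 0` for `n` large. -/

variable (W : Type*) [AddCommGroup W] [Module ℂ W]

/-- `ℰ(W) = Hom(W, W((x)))` as a submodule of `Hom(W, W[[x^{±1}]])`. -/
def EWsub : Submodule ℂ (W →ₗ[ℂ] (ℤ → W)) where
  carrier := {a | ∀ w : W, ∃ N : ℤ, ∀ n : ℤ, N ≤ n → a w n = 0}
  add_mem' := by
    intro a b ha hb w
    obtain ⟨N, hN⟩ := ha w
    obtain ⟨M, hM⟩ := hb w
    refine ⟨max N M, fun n hn => ?_⟩
    simp only [LinearMap.add_apply, Pi.add_apply,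
      hN n (le_trans (le_max_left _ _) hn), hM n (le_trans (le_max_right _ _) hn), add_zero]
  zero_mem' := by intro w; exact ⟨0, fun n _ => rfl⟩
  smul_mem' := by
    intro c a ha w
    obtain ⟨N, hN⟩ := ha w
    exact ⟨N, fun n hn => by
      simp only [LinearMap.smul_apply, Pi.smul_apply, hN n hn, smul_zero]⟩

/-- The type `ℰ(W)`. -/
abbrev EW := ↥(EWsub W)

variable {W}

/-- The mode function of an element of `ℰ(W)`. -/
def mf (a : EW W) : W → ℤ → W := fun w n => (a : W →ₗ[ℂ] (ℤ → W)) w n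

/-- The identity operator `1_W`, as an element of `ℰ(W)`. -/
def oneE : EW W :=
  ⟨{ toFun := fun w n => if n = -1 then w else 0
     map_add' := by
       intro w w'; funext n; by_cases h : n = -1 <;> simp [h]
     map_smul' := by
       intro c w; funext n; by_cases h : n = -1 <;> simp [h] },
   fun w => ⟨0, fun n hn => if_neg (by omega)⟩⟩

/-- The generalized binomial coefficient `C(m, j)` for `m ∈ ℤ`, as a complex number. -/
def binom (m : ℤ) (j : ℕ) : ℂ :=
  (∏ i ∈ Finset.range j, ((m : ℂ) - (i : ℂ))) / (j.factorial : ℂ)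

/-- The coefficient of `x₁^m x₂^t` in `a(x₁) b(x₂) w`. -/
def Fab (a b : EW W) (w : W) (m t : ℤ) : W := mf a (mf b w (-t - 1)) (-m - 1)

/-- Multiplication of a two-variable family by a polynomial `p(x₁,x₂)`. -/
def mulPoly (p : MvPolynomial (Fin 2) ℂ) (F : ℤ → ℤ → W) : ℤ → ℤ → W :=
  fun m t => ∑ d ∈ p.support, MvPolynomial.coeff d p • F (m - d 0) (t - d 1)

/-- A two-variable family lies in `W((x₁,x₂))` (jointly lower truncated). -/
def IsLaurent2 (F : ℤ → ℤ → W) : Prop :=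
  ∃ N : ℤ, ∀ m t : ℤ, (m < N ∨ t < N) → F m t = 0

/-- Quasi compatibility of an ordered pair `(a(x), b(x))` in `ℰ(W)`:
`p(x₁,x₂) a(x₁) b(x₂) ∈ Hom(W, W((x₁,x₂)))` for some nonzero polynomial `p`. -/
def QCPair (a b : EW W) : Prop :=
  ∃ p : MvPolynomial (Fin 2) ℂ, p ≠ 0 ∧ ∀ w, IsLaurent2 (mulPoly p (Fab a b w))

/-! ### Sequences -/

/-- The coefficient of `x₁^{k 1} ⋯ x_r^{k r}` in `ψ₁(x₁) ⋯ ψ_r(x_r) w`. -/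
def seqCoeff : {r : ℕ} → (Fin r → EW W) → W → (Fin r → ℤ) → W
  | 0, _, w, _ => w
  | _ + 1, ψ, w, k => mf (ψ 0) (seqCoeff (Fin.tail ψ) w (Fin.tail k)) (-(k 0) - 1)

/-- The polynomial `∏_{1 ≤ i < j ≤ r} p(x_i, x_j)`. -/
def pairPoly (p : MvPolynomial (Fin 2) ℂ) (r : ℕ) : MvPolynomial (Fin r) ℂ :=
  ∏ ij ∈ Finset.univ.filter (fun ij : Fin r × Fin r => ij.1 < ij.2),
    MvPolynomial.rename ![ij.1, ij.2] p

/-- Multiplication of an `r`-variable family by a polynomial in `r` variables. -/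
def mulPolyN {r : ℕ} (P : MvPolynomial (Fin r) ℂ) (F : (Fin r → ℤ) → W) :
    (Fin r → ℤ) → W :=
  fun k => ∑ d ∈ P.support, MvPolynomial.coeff d P • F (fun i => k i - d i)

/-- An `r`-variable family lies in `W((x₁,…,x_r))`. -/
def IsLaurentN {r : ℕ} (F : (Fin r → ℤ) → W) : Prop :=
  ∃ N : ℤ, ∀ k : Fin r → ℤ, (∃ i, k i < N) → F k = 0

/-- Quasi compatibility of an ordered sequence in `ℰ(W)`. -/
def QCSeq {r : ℕ} (ψ : Fin r → EW W) : Prop :=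
  ∃ p : MvPolynomial (Fin 2) ℂ, p ≠ 0 ∧
    ∀ w, IsLaurentN (mulPolyN (pairPoly p r) (seqCoeff ψ w))

/-- Quasi compatibility of a subset of `ℰ(W)`. -/
def QCSet (S : Set (EW W)) : Prop :=
  ∀ (r : ℕ) (ψ : Fin r → EW W), (∀ i, ψ i ∈ S) → QCSeq ψ

/-! ### The vertex operation `Y_ℰ^{(α)}` -/

/-- `ℂ((x))`. -/
abbrev LC : Type := LaurentSeries ℂ

/-- An iterated Laurent series field, e.g. `ℂ((x))((x₀))` (outer variable the second one). -/
abbrev K2 : Type := HahnSeries ℤ LC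

/-- The outer variable of `K2`. -/
def xOuter : K2 := HahnSeries.single 1 1

/-- The inner variable of `K2`. -/
def xInner : K2 := HahnSeries.single 0 (HahnSeries.single 1 1)

/-- `α` times the inner variable of `K2`. -/
def xInnerC (c : ℂ) : K2 := HahnSeries.single 0 (HahnSeries.single 1 c)

/-- The polynomial `p(x₀ + α x, x)` as an element of `ℂ((x))((x₀))`
(outer variable `x₀`). -/
def qK (p : MvPolynomial (Fin 2) ℂ) (α : ℂ) : K2 :=
  MvPolynomial.aeval ![xOuter + xInnerC α, xInner] p

/-- The expansion `ι_{x,x₀} (p(x₀ + α x, x)^{-1}) ∈ ℂ((x))((x₀))`. -/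
def qInv (p : MvPolynomial (Fin 2) ℂ) (α : ℂ) : K2 := (qK p α)⁻¹

/-- The coefficient of `x₀^j x^t` in `(p(x₁,x) a(x₁) b(x) w)|_{x₁ = αx + x₀}`,
expanding via `(αx+x₀)^m = ∑_{j≥0} C(m,j) α^{m-j} x^{m-j} x₀^j`. -/
def substYE (α : ℂ) (p : MvPolynomial (Fin 2) ℂ) (a b : EW W) (w : W)
    (j : ℕ) (t : ℤ) : W :=
  ∑ᶠ m : ℤ, (binom m j * α ^ (m - (j : ℤ))) • mulPoly p (Fab a b w) m (t - m + j)

/-- The coefficient of `x₀^J x^T` in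
`ι_{x,x₀}(p(x₀+αx,x)^{-1}) ⬝ (p(x₁,x)a(x₁)b(x)w)|_{x₁ = αx+x₀}`. -/
def fullYE (α : ℂ) (p : MvPolynomial (Fin 2) ℂ) (a b : EW W) (w : W)
    (J T : ℤ) : W :=
  ∑ᶠ s : ℤ × ℤ, (((qInv p α).coeff s.1).coeff s.2) •
    (if 0 ≤ J - s.1 then substYE α p a b w (J - s.1).toNat (T - s.2) else 0)

/-- The raw mode family of `Y_ℰ^{(α)}(a(x), x₀) b(x)`; `rawYE α a b n w m` is the mode
`m` of the element `a(x)_{(α,n)} b(x)` applied to `w`.  (Defined using a choice of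
polynomial from quasi compatibility; by the general theory the value does not depend
on the choice.) -/
def rawYE (α : ℂ) (a b : EW W) (n : ℤ) (w : W) (m : ℤ) : W :=
  if h : QCPair a b then fullYE α h.choose a b w (-n - 1) (-m - 1) else 0

/-- `a(x)_{(α,n)} b(x)`, as an element of `ℰ(W)` whenever the raw family is realized
by one (which is the case for any quasi compatible pair). -/
def YEa (α : ℂˣ) (a b : EW W) (n : ℤ) : EW W :=
  if h : ∃ c : EW W, ∀ w m, mf c w m = rawYE (α : ℂ) a b n w m then h.choose else 0

/-- `a(x)_n b(x) = a(x)_{(1,n)} b(x)`. -/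
def YE (a b : EW W) (n : ℤ) : EW W := YEa 1 a b n

end NVA

namespace NVA

variable {W : Type*} [AddCommGroup W] [Module ℂ W]

/-- Submodules of `ℰ(W)` are `ℂ`-vector spaces (registered explicitly to assist
instance resolution). -/
noncomputable instance (V : Submodule ℂ (EW W)) : AddCommGroup ↥V :=
  @Submodule.addCommGroup ℂ (EW W) _ inferInstance inferInstance V

noncomputable instance (V : Submodule ℂ (EW W)) : Module ℂ ↥V :=
  @Submodule.module ℂ (EW W) _ inferInstance inferInstance V

/-! ### Derivative and scaling operators on ℰ(W) -/

/-- `D = d/dx` on `ℰ(W)`: `(Da)_m = -m • a_{m-1}`. -/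
def Dop (a : EW W) : EW W :=
  ⟨{ toFun := fun w m => (-m : ℂ) • mf a w (m - 1)
     map_add' := by intro w w'; funext m; simp [mf, map_add]
     map_smul' := by
       intro c w; funext m
       simp only [mf, map_smul, Pi.smul_apply, RingHom.id_apply]
       exact smul_comm _ _ _ },
   by
     intro w
     obtain ⟨N, hN⟩ := a.2 w
     exact ⟨N + 1, fun m hm => by
       have : (a : W →ₗ[ℂ] (ℤ → W)) w (m - 1) = 0 := hN _ (by omega)
       simp [mf, this]⟩⟩

/-- `R_α : a(x) ↦ a(αx)`, on modes `(R_α a)_m = α^{-m-1} a_m`. -/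
def RaE (α : ℂˣ) (a : EW W) : EW W :=
  ⟨{ toFun := fun w m => ((α : ℂ) ^ (-m - 1 : ℤ)) • mf a w m
     map_add' := by intro w w'; funext m; simp [mf, map_add]
     map_smul' := by
       intro c w; funext m
       simp only [mf, map_smul, Pi.smul_apply, RingHom.id_apply]
       exact smul_comm _ _ _ },
   by
     intro w
     obtain ⟨N, hN⟩ := a.2 w
     exact ⟨N, fun m hm => by simp [mf, hN m hm]⟩⟩

/-! ### Nonlocal vertex algebras, modules and quasi modules -/

/-- The coefficient of `x₀^a x₂^b` in `Y₁(u, x₀+x₂) (Y₂(v,x₂) w)`, where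
`(x₀+x₂)^m` is expanded in nonnegative powers of `x₂`. -/
def prodCE {V : Type*} (Yo Yi : V → W → ℤ → W) (u v : V) (w : W) (a b : ℤ) : W :=
  ∑ᶠ m : ℤ, if a ≤ m then
    binom m (m - a).toNat • Yo u (Yi v w (-(b - (m - a)) - 1)) (-m - 1) else 0

/-- The coefficient of `x₀^a x₂^b` in `Y₂(Y₁(u,x₀)v, x₂) w`. -/
def assocCE {V : Type*} (Y1 : V → V → ℤ → V) (Y2 : V → W → ℤ → W)
    (u v : V) (w : W) (a b : ℤ) : W :=
  Y2 (Y1 u v (-a - 1)) w (-b - 1)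

/-- Multiplication of a two-variable family (in `x₀, x₂`) by `f(x₀+x₂, x₂)` for a
polynomial `f`, expanding `(x₀+x₂)^d` in nonnegative powers of `x₂`. -/
def mulSubPoly (f : MvPolynomial (Fin 2) ℂ) (A : ℤ → ℤ → W) (a b : ℤ) : W :=
  ∑ d ∈ f.support, ∑ i ∈ Finset.range (d 0 + 1),
    (MvPolynomial.coeff d f * ((d 0).choose i : ℂ)) •
      A (a - ((d 0 : ℤ) - i)) (b - i - (d 1 : ℤ))

/-- A nonlocal vertex algebra structure on a ℂ-vector space `V`:
a linear map `Y : V → ℰ(V) = Hom(V, V((x)))` and a vacuum vector `1` such that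
`Y(1,x)v = v`, `Y(v,x)1 ∈ V[[x]]` with constant term `v`, and weak associativity
holds. -/
structure NLVA (V : Type*) [AddCommGroup V] [Module ℂ V] where
  Y : V →ₗ[ℂ] EW V
  one : V
  vac : ∀ (v : V) (n : ℤ), mf (Y one) v n = if n = -1 then v else 0
  creation0 : ∀ (v : V) (n : ℤ), 0 ≤ n → mf (Y v) one n = 0
  creation1 : ∀ v : V, mf (Y v) one (-1) = v
  wassoc : ∀ u v w : V, ∃ l : ℕ, ∀ a b : ℤ,
    mulSubPoly (MvPolynomial.X 0 ^ l)
      (prodCE (fun x => mf (Y x)) (fun x => mf (Y x)) u v w) a b =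
    mulSubPoly (MvPolynomial.X 0 ^ l)
      (assocCE (fun x y n => mf (Y x) y n) (fun x => mf (Y x)) u v w) a b

/-- The mode maps of a nonlocal vertex algebra: `Yf A u v n = u_n v`. -/
def Yf {V : Type*} [AddCommGroup V] [Module ℂ V] (A : NLVA V) : V → V → ℤ → V :=
  fun u v n => mf (A.Y u) v n

/-- Mode maps of a linear map `V → ℰ(W)`. -/
def YWf {V : Type*} [AddCommGroup V] [Module ℂ V] (YW : V →ₗ[ℂ] EW W) :
    V → W → ℤ → W := fun v w n => mf (YW v) w n

/-- `(W, Y_W)` is a quasi module for the nonlocal vertex algebra `A` on `V`. -/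
def IsQuasiModule {V : Type*} [AddCommGroup V] [Module ℂ V] (A : NLVA V)
    (YW : V →ₗ[ℂ] EW W) : Prop :=
  (∀ (w : W) (n : ℤ), mf (YW A.one) w n = if n = -1 then w else 0) ∧
  ∀ (u v : V) (w : W), ∃ f : MvPolynomial (Fin 2) ℂ, f ≠ 0 ∧ ∀ a b : ℤ,
    mulSubPoly f (prodCE (YWf YW) (YWf YW) u v w) a b =
    mulSubPoly f (assocCE (Yf A) (YWf YW) u v w) a b

/-- `(W, Y_W)` is a module for the nonlocal vertex algebra `A` on `V`. -/
def IsModule {V : Type*} [AddCommGroup V] [Module ℂ V] (A : NLVA V)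
    (YW : V →ₗ[ℂ] EW W) : Prop :=
  (∀ (w : W) (n : ℤ), mf (YW A.one) w n = if n = -1 then w else 0) ∧
  ∀ (u v : V) (w : W), ∃ l : ℕ, ∀ a b : ℤ,
    mulSubPoly (MvPolynomial.X 0 ^ l) (prodCE (YWf YW) (YWf YW) u v w) a b =
    mulSubPoly (MvPolynomial.X 0 ^ l) (assocCE (Yf A) (YWf YW) u v w) a b

end NVA

namespace NVA

/-! ### Two-variable families as modules over polynomials -/

section Families

variable {W : Type*} [AddCommGroup W] [Module ℂ W]

/-- Multiplication of a two-variable family by the monomial with exponent `d`. -/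
def monomialShift (d : Fin 2 →₀ ℕ) : Module.End ℂ (ℤ → ℤ → W) where
  toFun F m t := F (m - d 0) (t - d 1)
  map_add' _ _ := rfl
  map_smul' _ _ := rfl

/-- The action of polynomials on two-variable families by multiplication. -/
def polyAct : MvPolynomial (Fin 2) ℂ →ₐ[ℂ] Module.End ℂ (ℤ → ℤ → W) :=
  AddMonoidAlgebra.lift ℂ _ _
    { toFun := fun d => monomialShift d.toAdd
      map_one' := by
        ext F m t
        simp [monomialShift]
      map_mul' := by
        intro d e
        ext F m t
        simp [monomialShift, sub_sub] }

theorem polyAct_apply (p : MvPolynomial (Fin 2) ℂ) (F : ℤ → ℤ → W) :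
    polyAct p F = mulPoly p F := by
  funext m t
  rw [polyAct, AddMonoidAlgebra.lift_apply, MvPolynomial.sum_def]
  simp [mulPoly, monomialShift, LinearMap.sum_apply, Finset.sum_apply]

theorem mulPoly_mul (p q : MvPolynomial (Fin 2) ℂ) (F : ℤ → ℤ → W) :
    mulPoly (p * q) F = mulPoly p (mulPoly q F) := by
  simp only [← polyAct_apply, map_mul, Module.End.mul_apply]

theorem mulPoly_add (p q : MvPolynomial (Fin 2) ℂ) (F : ℤ → ℤ → W) :
    mulPoly (p + q) F = mulPoly p F + mulPoly q F := by
  simp only [← polyAct_apply, map_add, LinearMap.add_apply]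

theorem mulPoly_C (c : ℂ) (F : ℤ → ℤ → W) : mulPoly (MvPolynomial.C c) F = c • F := by
  rw [← polyAct_apply, ← MvPolynomial.algebraMap_eq, AlgHom.commutes, Module.algebraMap_end_apply]

theorem mulPoly_monomial (d : Fin 2 →₀ ℕ) (c : ℂ) (F : ℤ → ℤ → W) :
    mulPoly (MvPolynomial.monomial d c) F = fun m t => c • F (m - d 0) (t - d 1) := by
  funext m t
  by_cases hc : c = 0
  · simp [mulPoly, hc]
  · simp [mulPoly, MvPolynomial.support_monomial, hc]

theorem mulPoly_X_zero (F : ℤ → ℤ → W) :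
    mulPoly (MvPolynomial.X 0) F = fun m t => F (m - 1) t := by
  rw [MvPolynomial.X, mulPoly_monomial]
  simp

theorem mulPoly_X_one (F : ℤ → ℤ → W) :
    mulPoly (MvPolynomial.X 1) F = fun m t => F m (t - 1) := by
  rw [MvPolynomial.X, mulPoly_monomial]
  simp

theorem mulPoly_X_zero_pow (k : ℕ) (F : ℤ → ℤ → W) :
    mulPoly (MvPolynomial.X 0 ^ k) F = fun m t => F (m - k) t := by
  rw [MvPolynomial.X_pow_eq_monomial, mulPoly_monomial]
  simp

theorem mulPoly_comm (p q : MvPolynomial (Fin 2) ℂ) (F : ℤ → ℤ → W) :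
    mulPoly p (mulPoly q F) = mulPoly q (mulPoly p F) := by
  rw [← mulPoly_mul, mul_comm, mulPoly_mul]

/-- A class of families closed under linear operations and multiplication by the variables is
closed under multiplication by polynomials. -/
theorem mulPoly_induction {P : (ℤ → ℤ → W) → Prop}
    (hadd : ∀ F G, P F → P G → P (F + G)) (hsmul : ∀ (c : ℂ) F, P F → P (c • F))
    (h0 : ∀ F, P F → P fun m t => F (m - 1) t) (h1 : ∀ F, P F → P fun m t => F m (t - 1))
    (p : MvPolynomial (Fin 2) ℂ) {F : ℤ → ℤ → W} (hF : P F) : P (mulPoly p F) := by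
  induction p using MvPolynomial.induction_on with
  | C c => rw [mulPoly_C]; exact hsmul c F hF
  | add p q hp hq => rw [mulPoly_add]; exact hadd _ _ hp hq
  | mul_X p i hp =>
    rw [mul_comm, mulPoly_mul]
    fin_cases i
    · exact (mulPoly_X_zero (mulPoly p F)).symm ▸ h0 _ hp
    · exact (mulPoly_X_one (mulPoly p F)).symm ▸ h1 _ hp

theorem IsLaurent2.mulPoly (p : MvPolynomial (Fin 2) ℂ) {F : ℤ → ℤ → W} (hF : IsLaurent2 F) :
    IsLaurent2 (NVA.mulPoly p F) := by
  refine mulPoly_induction ?_ ?_ ?_ ?_ p hF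
  · rintro F G ⟨N, hN⟩ ⟨M, hM⟩
    refine ⟨min N M, fun m t h => ?_⟩
    simp only [Pi.add_apply, hN m t (by omega), hM m t (by omega), add_zero]
  · rintro c F ⟨N, hN⟩
    exact ⟨N, fun m t h => by simp only [Pi.smul_apply, hN m t h, smul_zero]⟩
  · rintro F ⟨N, hN⟩
    exact ⟨N, fun m t h => hN _ _ (by omega)⟩
  · rintro F ⟨N, hN⟩
    exact ⟨N, fun m t h => hN _ _ (by omega)⟩

/-- The substitution `p(x₁, x₂) ↦ p(x₀ + x₂, x₂)` on polynomials. -/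
abbrev shiftPoly : MvPolynomial (Fin 2) ℂ →ₐ[ℂ] MvPolynomial (Fin 2) ℂ :=
  MvPolynomial.aeval ![MvPolynomial.X 0 + MvPolynomial.X 1, MvPolynomial.X 1]

theorem mulSubPoly_X_zero_pow (l : ℕ) (F : ℤ → ℤ → W) :
    mulSubPoly (MvPolynomial.X 0 ^ l) F =
      mulPoly ((MvPolynomial.X 0 + MvPolynomial.X 1) ^ l) F := by
  funext a b
  rw [add_comm, add_pow, ← polyAct_apply, map_sum, LinearMap.sum_apply, Finset.sum_apply,
    Finset.sum_apply, mulSubPoly, MvPolynomial.X_pow_eq_monomial,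
    MvPolynomial.support_monomial, if_neg one_ne_zero, Finset.sum_singleton]
  simp only [Finsupp.single_eq_same]
  refine Finset.sum_congr rfl fun i hi => ?_
  have hi' : i ≤ l := Nat.lt_succ_iff.1 (Finset.mem_range.1 hi)
  rw [polyAct_apply, mul_comm, ← map_natCast MvPolynomial.C, mulPoly_mul, mulPoly_C,
    MvPolynomial.X_pow_eq_monomial, MvPolynomial.X_pow_eq_monomial, MvPolynomial.monomial_mul,
    mulPoly_monomial]
  simp [Nat.cast_sub hi']

/-! ### Linear substitutions -/

/-- The binomial coefficient `C(m, j)`, equal to `0` for `j < 0`. -/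
def intBinom (m j : ℤ) : ℂ := if 0 ≤ j then binom m j.toNat else 0

theorem binom_succ_succ (m : ℤ) (j : ℕ) :
    binom (m + 1) (j + 1) = binom m j + binom m (j + 1) := by
  have hj : ((j.factorial : ℕ) : ℂ) ≠ 0 := by exact_mod_cast j.factorial_ne_zero
  have hj' : (j : ℂ) + 1 ≠ 0 := by exact_mod_cast j.succ_ne_zero
  have h : ∏ i ∈ Finset.range j, (((m + 1 : ℤ) : ℂ) - ((i + 1 : ℕ) : ℂ)) =
      ∏ i ∈ Finset.range j, ((m : ℂ) - (i : ℂ)) :=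
    Finset.prod_congr rfl fun i _ => by push_cast; ring
  simp only [binom]
  rw [Finset.prod_range_succ', h, Finset.prod_range_succ, Nat.factorial_succ]
  push_cast
  field_simp
  ring

theorem intBinom_succ (m j : ℤ) :
    intBinom (m + 1) j = intBinom m (j - 1) + intBinom m j := by
  rcases lt_trichotomy j 0 with h | rfl | h
  · simp [intBinom, not_le.2 h, show ¬ 1 ≤ j by omega]
  · simp [intBinom, binom]
  · obtain ⟨n, rfl⟩ : ∃ n : ℕ, j = n + 1 := ⟨(j - 1).toNat, by omega⟩
    simp only [intBinom, add_sub_cancel_right, Int.natCast_nonneg, if_true,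
      show (0 : ℤ) ≤ n + 1 by omega, Int.toNat_natCast, show ((n : ℤ) + 1).toNat = n + 1 by omega]
    exact binom_succ_succ m n

theorem binom_eq_choose (n j : ℕ) : binom n j = (n.choose j : ℂ) := by
  induction n generalizing j with
  | zero => cases j <;> simp [binom, Finset.prod_range_succ']
  | succ n ih =>
    cases j with
    | zero => simp [binom]
    | succ j =>
      rw [Nat.cast_succ, binom_succ_succ, ih, ih, Nat.choose_succ_succ, Nat.cast_add]

theorem intBinom_symm {m : ℤ} (hm : 0 ≤ m) (a : ℤ) : intBinom m (m - a) = intBinom m a := by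
  lift m to ℕ using hm
  rcases lt_or_ge a 0 with ha | ha
  · rw [intBinom, intBinom, if_neg (not_le.2 ha), if_pos (by omega), binom_eq_choose,
      Nat.choose_eq_zero_of_lt (by omega), Nat.cast_zero]
  lift a to ℕ using ha
  rcases lt_or_ge m a with h | h
  · rw [intBinom, intBinom, if_neg (by omega), if_pos (by omega), binom_eq_choose, Int.toNat_natCast,
      Nat.choose_eq_zero_of_lt h, Nat.cast_zero]
  · rw [intBinom, intBinom, if_pos (by omega), if_pos (by omega), binom_eq_choose, binom_eq_choose,
      ← Nat.cast_sub h, Int.toNat_natCast, Int.toNat_natCast, Nat.choose_symm h]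

end Families

section Substitution

variable {W : Type*} [AddCommGroup W] {c : ℤ → ℤ → ℂ}

/-- Every substitution sum formed from `F` with coefficients `c`, possibly shifted, is finite. -/
def Substitutable (c : ℤ → ℤ → ℂ) (F : ℤ → ℤ → W) : Prop :=
  ∀ a b : ℤ, {m | c m a ≠ 0 ∧ F m (b - m) ≠ 0}.Finite

theorem Substitutable.add {F G : ℤ → ℤ → W} (hF : Substitutable c F) (hG : Substitutable c G) :
    Substitutable c (F + G) := fun a b => by
  refine ((hF a b).union (hG a b)).subset fun m hm => ?_
  by_contra h
  simp only [Set.mem_union, Set.mem_ofPred_eq, Pi.add_apply] at h hm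
  aesop

theorem Substitutable.shift_right {F : ℤ → ℤ → W} (hF : Substitutable c F) :
    Substitutable c fun m t => F m (t - 1) := fun a b =>
  (hF a (b - 1)).subset fun m hm => ⟨hm.1, by
    rw [sub_right_comm]; exact hm.2⟩

theorem Substitutable.shift_left (hc : ∀ m a, c (m + 1) a = c m (a - 1) + c m a)
    {F : ℤ → ℤ → W} (hF : Substitutable c F) :
    Substitutable c fun m t => F (m - 1) t := fun a b => by
  refine (((hF (a - 1) (b - 1)).union (hF a (b - 1))).image (· + 1)).subset fun m hm => ?_
  refine ⟨m - 1, ?_, by simp⟩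
  have h1 := hc (m - 1) a
  rw [sub_add_cancel] at h1
  have h2 : F (m - 1) (b - 1 - (m - 1)) ≠ 0 := by
    rw [show b - 1 - (m - 1) = b - m by ring]; exact hm.2
  by_contra h
  simp only [Set.mem_union, Set.mem_ofPred_eq] at h
  refine hm.1 (h1.trans ?_)
  aesop

theorem intBinom_of_neg {m j : ℤ} (h : j < 0) : intBinom m j = 0 := if_neg (not_le.2 h)

theorem IsLaurent2.substitutable {F : ℤ → ℤ → W} (hF : IsLaurent2 F) (c : ℤ → ℤ → ℂ) :
    Substitutable c F := fun a b => by
  obtain ⟨N, hN⟩ := hF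
  refine (Set.finite_Icc N (b - N)).subset fun m hm => ?_
  by_contra h
  rw [Set.mem_Icc] at h
  exact hm.2 (hN _ _ (by omega))

/-- `F` involves only powers of `x₂` with exponents bounded below. -/
def TruncatedRight (F : ℤ → ℤ → W) : Prop := ∃ T : ℤ, ∀ m t : ℤ, t < T → F m t = 0

theorem TruncatedRight.substitutable {F : ℤ → ℤ → W} (hF : TruncatedRight F) :
    Substitutable (fun m a => intBinom m (m - a)) F := fun a b => by
  obtain ⟨T, hT⟩ := hF
  refine (Set.finite_Icc a (b - T)).subset fun m hm => ?_
  by_contra h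
  rw [Set.mem_Icc, not_and_or] at h
  rcases h with h | h
  · exact hm.1 (intBinom_of_neg (by omega))
  · exact hm.2 (hT _ _ (by omega))

variable [Module ℂ W]

theorem Substitutable.smul (r : ℂ) {F : ℤ → ℤ → W} (hF : Substitutable c F) :
    Substitutable c (r • F) := fun a b =>
  (hF a b).subset fun _ hm => ⟨hm.1, fun h => hm.2 (by simp [h])⟩

theorem Substitutable.mulPoly (hc : ∀ m a, c (m + 1) a = c m (a - 1) + c m a)
    (p : MvPolynomial (Fin 2) ℂ) {F : ℤ → ℤ → W} (hF : Substitutable c F) :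
    Substitutable c (NVA.mulPoly p F) :=
  mulPoly_induction (fun _ _ => .add) (fun r _ => .smul r) (fun _ => .shift_left hc)
    (fun _ => .shift_right) p hF

/-- The coefficient of `x₀^a x₂^b` obtained from the family `F` by expanding each `x₁^m`
as `∑ a, c m a • x₀^a x₂^(m - a)`. -/
def substFamily (c : ℤ → ℤ → ℂ) (F : ℤ → ℤ → W) (a b : ℤ) : W :=
  ∑ᶠ m : ℤ, c m a • F m (b - m + a)

theorem Substitutable.hasFiniteSupport {F : ℤ → ℤ → W} (hF : Substitutable c F) (a b a' : ℤ) :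
    Function.HasFiniteSupport fun m => c m a' • F m (b - m + a) :=
  (hF a' (b + a)).subset fun m hm => by
    rw [Function.mem_support, ne_eq, smul_eq_zero, not_or] at hm
    exact ⟨hm.1, by rw [show b + a - m = b - m + a by ring]; exact hm.2⟩

theorem substFamily_add {F G : ℤ → ℤ → W} (hF : Substitutable c F) (hG : Substitutable c G) :
    substFamily c (F + G) = substFamily c F + substFamily c G := by
  funext a b
  simp only [substFamily, Pi.add_apply, smul_add]
  exact finsum_add_distrib (hF.hasFiniteSupport a b a) (hG.hasFiniteSupport a b a)

theorem substFamily_smul (r : ℂ) (F : ℤ → ℤ → W) :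
    substFamily c (r • F) = r • substFamily c F := by
  funext a b
  simp only [substFamily, Pi.smul_apply, smul_finsum, smul_comm r]

/-- Substitution turns multiplication by `p(x₁, x₂)` into multiplication by `p(x₀ + x₂, x₂)`. -/
theorem substFamily_mulPoly (hc : ∀ m a, c (m + 1) a = c m (a - 1) + c m a)
    (p : MvPolynomial (Fin 2) ℂ) {F : ℤ → ℤ → W} (hF : Substitutable c F) :
    substFamily c (mulPoly p F) = mulPoly (shiftPoly p) (substFamily c F) := by
  induction p using MvPolynomial.induction_on with
  | C r =>
    rw [mulPoly_C, substFamily_smul, ← MvPolynomial.algebraMap_eq, AlgHom.commutes,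
      MvPolynomial.algebraMap_eq, mulPoly_C]
  | add p q hp hq =>
    rw [mulPoly_add, substFamily_add (hF.mulPoly hc p) (hF.mulPoly hc q), hp, hq, map_add,
      mulPoly_add]
  | mul_X p i hp =>
    have hG := hF.mulPoly hc p
    rw [mul_comm, mulPoly_mul, map_mul, mulPoly_mul, ← hp]
    generalize mulPoly p F = G at hG
    rw [shiftPoly, MvPolynomial.aeval_X]
    fin_cases i
    · change substFamily c (mulPoly (MvPolynomial.X 0) G) =
        mulPoly (MvPolynomial.X 0 + MvPolynomial.X 1) (substFamily c G)
      rw [mulPoly_add, mulPoly_X_zero, mulPoly_X_zero, mulPoly_X_one]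
      funext a b
      simp only [substFamily, Pi.add_apply]
      rw [← finsum_comp_equiv (Equiv.addRight (1 : ℤ)),
        ← finsum_add_distrib (hG.hasFiniteSupport (a - 1) b (a - 1))
          (hG.hasFiniteSupport a (b - 1) a)]
      refine finsum_congr fun m => ?_
      simp only [Equiv.coe_addRight, hc, add_smul, add_sub_cancel_right]
      rw [show b - (m + 1) + a = b - m + (a - 1) by ring,
        show b - 1 - m + a = b - m + (a - 1) by ring]
    · change substFamily c (mulPoly (MvPolynomial.X 1) G) =
        mulPoly (MvPolynomial.X 1) (substFamily c G)
      rw [mulPoly_X_one, mulPoly_X_one]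
      funext a b
      simp only [substFamily]
      refine finsum_congr fun m => ?_
      rw [show b - m + a - 1 = b - 1 - m + a by ring]

/-- Expansion of `x₁ = x₂ + x₀` in nonnegative powers of `x₀`. -/
abbrev substInner (F : ℤ → ℤ → W) : ℤ → ℤ → W := substFamily intBinom F

/-- Expansion of `x₁ = x₀ + x₂` in nonnegative powers of `x₂`. -/
abbrev substOuter (F : ℤ → ℤ → W) : ℤ → ℤ → W := substFamily (fun m a => intBinom m (m - a)) F

theorem intBinom_sub_succ (m a : ℤ) :
    intBinom (m + 1) (m + 1 - a) = intBinom m (m - (a - 1)) + intBinom m (m - a) := by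
  rw [intBinom_succ, add_comm, show m + 1 - a - 1 = m - a by ring,
    show m + 1 - a = m - (a - 1) by ring]

theorem TruncatedRight.mulPoly (p : MvPolynomial (Fin 2) ℂ) {F : ℤ → ℤ → W}
    (hF : TruncatedRight F) : TruncatedRight (NVA.mulPoly p F) := by
  refine mulPoly_induction ?_ ?_ ?_ ?_ p hF
  · rintro F G ⟨N, hN⟩ ⟨M, hM⟩
    refine ⟨min N M, fun m t h => ?_⟩
    simp only [Pi.add_apply, hN m t (by omega), hM m t (by omega), add_zero]
  · rintro c F ⟨N, hN⟩
    exact ⟨N, fun m t h => by simp only [Pi.smul_apply, hN m t h, smul_zero]⟩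
  · rintro F ⟨N, hN⟩
    exact ⟨N, fun m t h => hN _ _ h⟩
  · rintro F ⟨N, hN⟩
    exact ⟨N, fun m t h => hN _ _ (by omega)⟩

theorem mulPoly_eq_zero_of_lt {A : ℤ} {F : ℤ → ℤ → W} (hF : ∀ a b, a < A → F a b = 0)
    (p : MvPolynomial (Fin 2) ℂ) : ∀ a b, a < A → mulPoly p F a b = 0 := by
  refine mulPoly_induction (P := fun F => ∀ a b, a < A → F a b = 0) ?_ ?_ ?_ ?_ p hF
  · intro F G hF hG a b h
    simp only [Pi.add_apply, hF a b h, hG a b h, add_zero]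
  · intro c F hF a b h
    simp only [Pi.smul_apply, hF a b h, smul_zero]
  · exact fun F hF a b h => hF _ _ (by omega)
  · exact fun F hF a b h => hF _ _ h

/-- Multiplication by `(x₀ + x₂)^l` is injective on families truncated in powers of `x₀`. -/
theorem mulPoly_X_add_X_pow_cancel {A : ℤ} (l : ℕ) {F G : ℤ → ℤ → W}
    (hF : ∀ a b, a < A → F a b = 0) (hG : ∀ a b, a < A → G a b = 0)
    (h : mulPoly ((MvPolynomial.X 0 + MvPolynomial.X 1) ^ l) F =
      mulPoly ((MvPolynomial.X 0 + MvPolynomial.X 1) ^ l) G) : F = G := by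
  induction l with
  | zero => simpa [← polyAct_apply] using h
  | succ l ih =>
    apply ih
    rw [pow_succ', mulPoly_mul, mulPoly_mul] at h
    have hF' := mulPoly_eq_zero_of_lt hF ((MvPolynomial.X 0 + MvPolynomial.X 1) ^ l)
    have hG' := mulPoly_eq_zero_of_lt hG ((MvPolynomial.X 0 + MvPolynomial.X 1) ^ l)
    generalize mulPoly ((MvPolynomial.X 0 + MvPolynomial.X 1) ^ l) F = F' at *
    generalize mulPoly ((MvPolynomial.X 0 + MvPolynomial.X 1) ^ l) G = G' at *
    have key : ∀ n : ℕ, ∀ b, F' (A - 1 + n) b = G' (A - 1 + n) b := by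
      intro n
      induction n with
      | zero => intro b; rw [hF' _ _ (by simp), hG' _ _ (by simp)]
      | succ n ihn =>
        intro b
        have hb := congrFun (congrFun h (A - 1 + (n + 1 : ℕ))) (b + 1)
        simp only [mulPoly_add, mulPoly_X_zero, mulPoly_X_one, Pi.add_apply,
          add_sub_cancel_right] at hb
        rw [show A - 1 + ((n + 1 : ℕ) : ℤ) - 1 = A - 1 + n by push_cast; ring, ihn] at hb
        exact add_left_cancel hb
    funext a b
    rcases lt_or_ge a A with ha | ha
    · rw [hF' _ _ ha, hG' _ _ ha]
    · have := key (a - (A - 1)).toNat b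
      rwa [Int.toNat_of_nonneg (by omega), add_sub_cancel] at this

theorem mulPoly_X_zero_pow_injective (k : ℕ) :
    Function.Injective (mulPoly (W := W) (MvPolynomial.X 0 ^ k)) := by
  intro F G h
  funext a b
  simpa [mulPoly_X_zero_pow] using congrFun (congrFun h (a + k)) b

/-- If the outer expansion of `E` has only nonnegative powers of `x₀`, then `E` has only
nonnegative powers of `x₁`. -/
theorem eq_zero_of_substOuter_eq_zero {E : ℤ → ℤ → W} (hE : TruncatedRight E)
    (h : ∀ a b, a < 0 → substOuter E a b = 0) : ∀ m t, m < 0 → E m t = 0 := by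
  obtain ⟨T, hT⟩ := hE
  have key : ∀ n : ℕ, ∀ t, t < T + n → ∀ m, m < 0 → E m t = 0 := by
    intro n
    induction n with
    | zero => exact fun t ht m _ => hT m t (by simpa using ht)
    | succ n ih =>
      intro t ht m hm
      rw [← h m t hm, substOuter, substFamily, finsum_eq_single _ m]
      · simp [intBinom, binom]
      · intro m' hne
        rcases lt_or_gt_of_ne hne with hlt | hgt
        · rw [intBinom_of_neg (by omega), zero_smul]
        · rcases lt_or_ge m' 0 with h0 | h0
          · rw [ih _ (by push_cast at ht; omega) _ h0, smul_zero]
          · rw [intBinom_symm h0, intBinom_of_neg hm, zero_smul]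
  exact fun m t hm => key (t + 1 - T).toNat t (by omega) m hm

/-- Both expansions agree on families with only nonnegative powers of `x₁`. -/
theorem substOuter_eq_substInner {E : ℤ → ℤ → W} (hE : ∀ m t, m < 0 → E m t = 0) :
    substOuter E = substInner E := by
  funext a b
  refine finsum_congr fun m => ?_
  rcases lt_or_ge m 0 with h | h
  · rw [hE _ _ h, smul_zero, smul_zero]
  · simp only [intBinom_symm h]

theorem substInner_eq_zero_of_neg (F : ℤ → ℤ → W) (a b : ℤ) (ha : a < 0) :
    substInner F a b = 0 := by
  simp [substInner, substFamily, intBinom_of_neg ha]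

theorem shiftPoly_sub_pow (k : ℕ) :
    shiftPoly ((MvPolynomial.X 0 - MvPolynomial.X 1) ^ k) = MvPolynomial.X 0 ^ k := by
  simp [shiftPoly]

theorem shiftPoly_X_zero_pow (l : ℕ) :
    shiftPoly (MvPolynomial.X 0 ^ l) = (MvPolynomial.X 0 + MvPolynomial.X 1) ^ l := by
  simp [shiftPoly]

theorem TruncatedRight.substOuter_mulPoly {F : ℤ → ℤ → W} (hF : TruncatedRight F)
    (p : MvPolynomial (Fin 2) ℂ) :
    substOuter (NVA.mulPoly p F) = NVA.mulPoly (shiftPoly p) (substOuter F) :=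
  substFamily_mulPoly intBinom_sub_succ p hF.substitutable

theorem IsLaurent2.substInner_mulPoly {F : ℤ → ℤ → W} (hF : IsLaurent2 F)
    (p : MvPolynomial (Fin 2) ℂ) :
    substInner (NVA.mulPoly p F) = NVA.mulPoly (shiftPoly p) (substInner F) :=
  substFamily_mulPoly intBinom_succ p (hF.substitutable _)

/-- Weak associativity for a single vector implies compatibility and the iterate formula. -/
theorem isLaurent2_and_substInner_eq {F H : ℤ → ℤ → W} (hF : TruncatedRight F) {k l : ℕ}
    (hH : ∀ a b, a < -(k : ℤ) → H a b = 0)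
    (h : mulPoly ((MvPolynomial.X 0 + MvPolynomial.X 1) ^ l) (substOuter F) =
      mulPoly ((MvPolynomial.X 0 + MvPolynomial.X 1) ^ l) H) :
    IsLaurent2 (mulPoly ((MvPolynomial.X 0 - MvPolynomial.X 1) ^ k) F) ∧
      substInner (mulPoly ((MvPolynomial.X 0 - MvPolynomial.X 1) ^ k) F) =
        mulPoly (MvPolynomial.X 0 ^ k) H := by
  have hG := hF.mulPoly ((MvPolynomial.X 0 - MvPolynomial.X 1) ^ k)
  have hSG := hF.substOuter_mulPoly ((MvPolynomial.X 0 - MvPolynomial.X 1) ^ k)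
  rw [shiftPoly_sub_pow] at hSG
  generalize mulPoly ((MvPolynomial.X 0 - MvPolynomial.X 1) ^ k) F = G at *
  have hE := hG.mulPoly (MvPolynomial.X 0 ^ l)
  have hSE : substOuter (mulPoly (MvPolynomial.X 0 ^ l) G) =
      mulPoly ((MvPolynomial.X 0 + MvPolynomial.X 1) ^ l) (mulPoly (MvPolynomial.X 0 ^ k) H) := by
    rw [hG.substOuter_mulPoly, shiftPoly_X_zero_pow, hSG, mulPoly_comm, h, mulPoly_comm]
  have hkH : ∀ a b, a < 0 → mulPoly (MvPolynomial.X 0 ^ k) H a b = 0 := fun a b ha => by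
    rw [mulPoly_X_zero_pow]
    exact hH _ _ (by omega)
  have hE0 := eq_zero_of_substOuter_eq_zero hE fun a b ha => by
    rw [hSE]
    exact mulPoly_eq_zero_of_lt hkH _ a b ha
  have hL : IsLaurent2 G := by
    obtain ⟨T, hT⟩ := hG
    refine ⟨min T (-l), fun m t hmt => ?_⟩
    by_cases ht : t < T
    · exact hT m t ht
    · simpa [mulPoly_X_zero_pow] using hE0 (m + l) t (by omega)
  refine ⟨hL, mulPoly_X_add_X_pow_cancel (A := 0) l (substInner_eq_zero_of_neg G) hkH ?_⟩
  rw [← hSE, substOuter_eq_substInner hE0, hL.substInner_mulPoly, shiftPoly_X_zero_pow]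

/-- Compatibility and the iterate formula imply weak associativity. -/
theorem exists_mulPoly_substOuter_eq {F H : ℤ → ℤ → W} (hF : TruncatedRight F) {k : ℕ}
    (hL : IsLaurent2 (mulPoly ((MvPolynomial.X 0 - MvPolynomial.X 1) ^ k) F))
    (h : substInner (mulPoly ((MvPolynomial.X 0 - MvPolynomial.X 1) ^ k) F) =
      mulPoly (MvPolynomial.X 0 ^ k) H) :
    ∃ l : ℕ, mulPoly ((MvPolynomial.X 0 + MvPolynomial.X 1) ^ l) (substOuter F) =
      mulPoly ((MvPolynomial.X 0 + MvPolynomial.X 1) ^ l) H := by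
  have hG := hF.mulPoly ((MvPolynomial.X 0 - MvPolynomial.X 1) ^ k)
  have hSG := hF.substOuter_mulPoly ((MvPolynomial.X 0 - MvPolynomial.X 1) ^ k)
  rw [shiftPoly_sub_pow] at hSG
  generalize mulPoly ((MvPolynomial.X 0 - MvPolynomial.X 1) ^ k) F = G at *
  obtain ⟨N, hN⟩ := id hL
  refine ⟨(-N).toNat, mulPoly_X_zero_pow_injective k ?_⟩
  have hE0 : ∀ m t, m < 0 → mulPoly (MvPolynomial.X 0 ^ (-N).toNat) G m t = 0 :=
    fun m t hm => by
      rw [mulPoly_X_zero_pow]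
      exact hN _ _ (by omega)
  have hSR := substOuter_eq_substInner hE0
  rw [hG.substOuter_mulPoly, hL.substInner_mulPoly, shiftPoly_X_zero_pow, hSG, h] at hSR
  rw [mulPoly_comm, hSR, mulPoly_comm]

end Substitution

/-! ### Families as a vector space over iterated Laurent series -/

section HahnAction

/-- Laurent series with coefficients in an `R`-module, as a module over Laurent series in `R`. -/
abbrev LaurentModule (R X : Type*) [CommRing R] [AddCommGroup X] [Module R X] : Type _ :=
  HahnModule ℤ R X

theorem laurentModule_add_smul {R X : Type*} [CommRing R] [AddCommGroup X] [Module R X]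
    (f g : HahnSeries ℤ R) (x : LaurentModule R X) : (f + g) • x = f • x + g • x :=
  add_smul f g x

theorem laurentModule_mul_smul {R X : Type*} [CommRing R] [AddCommGroup X] [Module R X]
    (f g : HahnSeries ℤ R) (x : LaurentModule R X) : (f * g) • x = f • g • x :=
  mul_smul f g x

theorem laurentModule_one_smul {R X : Type*} [CommRing R] [AddCommGroup X] [Module R X]
    (x : LaurentModule R X) : (1 : HahnSeries ℤ R) • x = x :=
  one_smul _ x

theorem coeff_single_smul {R X : Type*} [CommRing R] [AddCommGroup X] [Module R X] (d : ℤ) (r : R)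
    (x : LaurentModule R X) (n : ℤ) :
    ((HahnModule.of R).symm (HahnSeries.single d r • x)).coeff n =
      r • ((HahnModule.of R).symm x).coeff (n - d) := by
  have h := HahnModule.coeff_single_smul_vadd (r := r) (x := x) (a := n - d) (b := d)
  rwa [vadd_eq_add, add_sub_cancel] at h

theorem hasFiniteSupport_coeff_smul {R X : Type*} [CommRing R] [AddCommGroup X] [Module R X]
    (f : HahnSeries ℤ R) (x : LaurentModule R X) (n : ℤ) :
    Function.HasFiniteSupport
      fun i => f.coeff i • ((HahnModule.of R).symm x).coeff (n - i) := by
  refine ((Finset.VAddAntidiagonal n (Set.VAddAntidiagonal.finite_of_isPWO f.isPWO_support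
    ((HahnModule.of R).symm x).isPWO_support n)).image Prod.fst).finite_toSet.subset fun i hi => ?_
  rw [Function.mem_support] at hi
  simp only [Finset.coe_image, Set.mem_image, Finset.mem_coe, Finset.mem_vaddAntidiagonal]
  exact ⟨(i, n - i), ⟨fun h => hi (by simp [h]), fun h => hi (by simp [h]), by simp⟩, rfl⟩

theorem coeff_smul_eq_finsum {R X : Type*} [CommRing R] [AddCommGroup X] [Module R X]
    (f : HahnSeries ℤ R) (x : LaurentModule R X) (n : ℤ) :
    ((HahnModule.of R).symm (f • x)).coeff n =
      ∑ᶠ i, f.coeff i • ((HahnModule.of R).symm x).coeff (n - i) := by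
  rw [HahnModule.coeff_smul, finsum_eq_sum_of_support_subset (s := (Finset.VAddAntidiagonal n
    (Set.VAddAntidiagonal.finite_of_isPWO f.isPWO_support
      ((HahnModule.of R).symm x).isPWO_support n)).image Prod.fst)]
  · rw [Finset.sum_image]
    · refine Finset.sum_congr rfl fun ij hij => ?_
      rw [Finset.mem_vaddAntidiagonal, vadd_eq_add] at hij
      rw [← hij.2.2, add_sub_cancel_left]
    · intro p hp q hq h
      rw [Finset.mem_coe, Finset.mem_vaddAntidiagonal, vadd_eq_add] at hp hq
      exact Prod.ext h (add_left_cancel (h ▸ hp.2.2.trans hq.2.2.symm))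
  · intro i hi
    rw [Function.mem_support] at hi
    simp only [Finset.coe_image, Set.mem_image, Finset.mem_coe, Finset.mem_vaddAntidiagonal]
    exact ⟨(i, n - i), ⟨fun h => hi (by simp [h]), fun h => hi (by simp [h]), by simp⟩, rfl⟩

variable {W : Type*} [AddCommGroup W] [Module ℂ W]

/-- The space `W((x))((x₀))`, as a vector space over `ℂ((x))((x₀))`. -/
abbrev IterLaurent (W : Type*) [AddCommGroup W] [Module ℂ W] : Type _ :=
  LaurentModule LC (LaurentModule ℂ W)

/-- The coefficient family of an element of `W((x))((x₀))`, with the exponent of `x₀` first. -/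
def IterLaurent.coeff (x : IterLaurent W) (a b : ℤ) : W :=
  ((HahnModule.of ℂ).symm (((HahnModule.of LC).symm x).coeff a)).coeff b

theorem IterLaurent.coeff_add_smul (f g : K2) (x : IterLaurent W) :
    ((f + g) • x).coeff = (f • x).coeff + (g • x).coeff :=
  congrArg IterLaurent.coeff (laurentModule_add_smul f g x)

theorem IterLaurent.coeff_mul_smul (f g : K2) (x : IterLaurent W) :
    ((f * g) • x).coeff = (f • g • x).coeff :=
  congrArg IterLaurent.coeff (laurentModule_mul_smul f g x)

theorem IterLaurent.coeff_one_smul (x : IterLaurent W) :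
    ((1 : K2) • x).coeff = x.coeff :=
  congrArg IterLaurent.coeff (laurentModule_one_smul x)

theorem IterLaurent.coeff_single_single_smul (d e : ℤ) (r : ℂ) (x : IterLaurent W) :
    ((HahnSeries.single d (HahnSeries.single e r) : K2) • x).coeff =
      fun a b => r • x.coeff (a - d) (b - e) := by
  funext a b
  rw [IterLaurent.coeff, coeff_single_smul, coeff_single_smul]
  rfl

theorem IterLaurent.exists_coeff_eq {F : ℤ → ℤ → W} {A : ℤ} (hA : ∀ a b, a < A → F a b = 0)
    (hB : ∀ a, ∃ B, ∀ b, b < B → F a b = 0) : ∃ x : IterLaurent W, x.coeff = F := by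
  choose B hB using hB
  let y : ℤ → LaurentModule ℂ W := fun a => HahnModule.of ℂ
    (HahnSeries.ofSuppBddBelow (F a) ⟨B a, fun b hb => not_lt.1 fun h => hb (hB a b h)⟩)
  refine ⟨HahnModule.of LC (HahnSeries.ofSuppBddBelow y
    ⟨A, fun a ha => not_lt.1 fun h => ha ?_⟩), rfl⟩
  exact HahnModule.ext _ _ (funext fun b => hA a b h)

/-- Polynomials in `x₀` (first variable) and `x` as elements of `ℂ((x))((x₀))`. -/
def polyK : MvPolynomial (Fin 2) ℂ →+* K2 :=
  (MvPolynomial.aeval ![xOuter, xInner] : MvPolynomial (Fin 2) ℂ →ₐ[ℂ] K2).toRingHom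

theorem polyK_X_zero : polyK (MvPolynomial.X 0) = xOuter :=
  MvPolynomial.aeval_X ![xOuter, xInner] 0

theorem polyK_X_one : polyK (MvPolynomial.X 1) = xInner :=
  MvPolynomial.aeval_X ![xOuter, xInner] 1

theorem polyK_C (r : ℂ) :
    polyK (MvPolynomial.C r) = HahnSeries.single 0 (HahnSeries.single 0 r) := by
  refine (MvPolynomial.aeval_C ![xOuter, xInner] r).trans ?_
  rw [HahnSeries.algebraMap_apply', PowerSeries.algebraMap_apply, HahnSeries.ofPowerSeries_C,
    HahnSeries.algebraMap_apply', PowerSeries.algebraMap_apply, HahnSeries.ofPowerSeries_C]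
  rfl

theorem polyK_monomial (d : Fin 2 →₀ ℕ) (r : ℂ) :
    polyK (MvPolynomial.monomial d r) =
      HahnSeries.single (d 0 : ℤ) (HahnSeries.single (d 1 : ℤ) r) := by
  rw [MvPolynomial.monomial_eq, map_mul, polyK_C, Finsupp.prod_fintype _ _ (by simp),
    Fin.prod_univ_two, map_mul, map_pow, map_pow, polyK_X_zero, polyK_X_one]
  simp only [xOuter, xInner, HahnSeries.single_pow,
    HahnSeries.single_mul_single, one_pow, nsmul_zero, zero_add, add_zero, mul_one, one_mul,
    nsmul_one]

theorem coeff_polyK (q : MvPolynomial (Fin 2) ℂ) (d : Fin 2 →₀ ℕ) :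
    ((polyK q).coeff (d 0)).coeff (d 1) = q.coeff d := by
  induction q using MvPolynomial.induction_on' with
  | monomial e r =>
    rw [polyK_monomial, HahnSeries.coeff_single, MvPolynomial.coeff_monomial]
    have he : e = d ↔ d 0 = e 0 ∧ d 1 = e 1 := by
      rw [Finsupp.ext_iff, Fin.forall_fin_two, eq_comm, @eq_comm _ (e 1)]
    split_ifs with h1 h2 h2
    · rw [h2, HahnSeries.coeff_single_same]
    · rw [HahnSeries.coeff_single, if_neg]
      exact fun h => h2 (he.2 ⟨by exact_mod_cast h1, by exact_mod_cast h⟩)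
    · exact absurd (by rw [h2]) h1
    · rfl
  | add p q hp hq =>
    rw [map_add, HahnSeries.coeff_add, HahnSeries.coeff_add, hp, hq,
      MvPolynomial.coeff_add]

theorem polyK_injective : Function.Injective polyK := by
  intro p q h
  ext d
  rw [← coeff_polyK, ← coeff_polyK, h]

theorem shiftPoly_injective : Function.Injective shiftPoly := by
  let ψ : MvPolynomial (Fin 2) ℂ →ₐ[ℂ] MvPolynomial (Fin 2) ℂ :=
    MvPolynomial.aeval ![MvPolynomial.X 0 - MvPolynomial.X 1, MvPolynomial.X 1]
  have h : ψ.comp shiftPoly = AlgHom.id ℂ _ := by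
    ext i
    fin_cases i <;> simp [ψ, shiftPoly]
  exact Function.LeftInverse.injective (g := ψ) fun p => DFunLike.congr_fun h p

theorem qK_one (p : MvPolynomial (Fin 2) ℂ) : qK p 1 = polyK (shiftPoly p) := by
  let φ : MvPolynomial (Fin 2) ℂ →+* K2 :=
    (MvPolynomial.aeval ![xOuter + xInnerC 1, xInner] :
      MvPolynomial (Fin 2) ℂ →ₐ[ℂ] K2).toRingHom
  have hC (r : ℂ) : shiftPoly (MvPolynomial.C r) = MvPolynomial.C r := by simp
  have hX0 : shiftPoly (MvPolynomial.X 0) = MvPolynomial.X 0 + MvPolynomial.X 1 := by simp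
  have hX1 : shiftPoly (MvPolynomial.X 1) = MvPolynomial.X 1 := by simp
  have h : φ = polyK.comp (shiftPoly : _ →+* _) := by
    refine MvPolynomial.ringHom_ext (fun r => ?_) fun i => ?_
    · rw [RingHom.comp_apply, RingHom.coe_coe, hC]
      refine (MvPolynomial.aeval_C ![xOuter + xInnerC 1, xInner] r).trans ?_
      exact (MvPolynomial.aeval_C ![xOuter, xInner] r).symm
    · refine (MvPolynomial.aeval_X ![xOuter + xInnerC 1, xInner] i).trans ?_
      rw [RingHom.comp_apply, RingHom.coe_coe]
      fin_cases i
      · rw [Fin.zero_eta, hX0, map_add, polyK_X_zero, polyK_X_one]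
        rfl
      · rw [Fin.mk_one, hX1, polyK_X_one]
        rfl
  exact DFunLike.congr_fun h p

theorem IterLaurent.coeff_polyK_smul (q : MvPolynomial (Fin 2) ℂ) (x : IterLaurent W) :
    (polyK q • x).coeff = mulPoly q x.coeff := by
  induction q using MvPolynomial.induction_on' with
  | monomial d r => rw [polyK_monomial, IterLaurent.coeff_single_single_smul, mulPoly_monomial]
  | add p q hp hq =>
    rw [map_add, IterLaurent.coeff_add_smul, mulPoly_add, hp, hq]

theorem IterLaurent.coeff_smul (f : K2) (x : IterLaurent W) (a b : ℤ) :
    (f • x).coeff a b =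
      ∑ᶠ s : ℤ × ℤ, (f.coeff s.1).coeff s.2 • x.coeff (a - s.1) (b - s.2) := by
  have h1 := hasFiniteSupport_coeff_smul f x a
  rw [finsum_curry]
  · let φ : LaurentModule ℂ W →+ W :=
      { toFun := fun y => ((HahnModule.of ℂ).symm y).coeff b
        map_zero' := rfl
        map_add' := fun _ _ => rfl }
    change φ (((HahnModule.of LC).symm (f • x)).coeff a) = _
    rw [coeff_smul_eq_finsum, φ.map_finsum h1]
    exact finsum_congr fun i => coeff_smul_eq_finsum _ _ _
  · refine (h1.biUnion (t := fun i => (fun j => (i, j)) '' Function.support fun j =>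
      (f.coeff i).coeff j • x.coeff (a - i) (b - j)) fun i _ => ?_).subset fun s hs => ?_
    · exact (hasFiniteSupport_coeff_smul (f.coeff i) _ b).image _
    · refine Set.mem_biUnion (x := s.1) (fun h0 => hs ?_) ⟨s.2, hs, rfl⟩
      rcases smul_eq_zero.1 h0 with h | h
      · simp [h]
      · simp [IterLaurent.coeff, h]

end HahnAction

/-! ### The vertex operation in terms of substitutions -/

section VertexOperation

variable {W : Type*} [AddCommGroup W] [Module ℂ W]

theorem IsLaurent2.exists_substInner_eq_zero {F : ℤ → ℤ → W} (hF : IsLaurent2 F) :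
    ∃ N : ℤ, ∀ a b, b < N - a → substInner F a b = 0 := by
  obtain ⟨N, hN⟩ := hF
  refine ⟨2 * N, fun a b hb => finsum_eq_zero_of_forall_eq_zero fun m => ?_⟩
  rw [hN m _ (by omega), smul_zero]

theorem substInner_eq_substYE (p : MvPolynomial (Fin 2) ℂ) (a b : EW W) (w : W) (J T : ℤ) :
    (if 0 ≤ J then substYE 1 p a b w J.toNat T else 0) =
      substInner (mulPoly p (Fab a b w)) J T := by
  split_ifs with h
  · obtain ⟨j, rfl⟩ := Int.eq_ofNat_of_zero_le h
    refine finsum_congr fun m => ?_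
    simp [intBinom]
  · exact (substInner_eq_zero_of_neg _ _ _ (not_le.1 h)).symm

theorem fullYE_eq {p : MvPolynomial (Fin 2) ℂ} (hp : p ≠ 0) {a b : EW W} {w : W} {k : ℕ}
    (hL : IsLaurent2 (mulPoly p (Fab a b w)))
    (hG : IsLaurent2 (mulPoly ((MvPolynomial.X 0 - MvPolynomial.X 1) ^ k) (Fab a b w)))
    (J T : ℤ) :
    fullYE 1 p a b w J T = substInner
      (mulPoly ((MvPolynomial.X 0 - MvPolynomial.X 1) ^ k) (Fab a b w)) (J + k) T := by
  set F := Fab a b w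
  set G := mulPoly ((MvPolynomial.X 0 - MvPolynomial.X 1) ^ k) F with hGdef
  obtain ⟨N, hN⟩ := hG.exists_substInner_eq_zero
  obtain ⟨x, hx⟩ := IterLaurent.exists_coeff_eq
    (F := fun a b => substInner G (a + k) b) (A := -k)
    (fun a b ha => substInner_eq_zero_of_neg _ _ _ (by omega))
    (fun a => ⟨N - (a + k), fun b hb => hN _ _ hb⟩)
  have hxk : mulPoly (MvPolynomial.X 0 ^ k) x.coeff = substInner G := by
    rw [hx, mulPoly_X_zero_pow]
    simp
  have hpx : substInner (mulPoly p F) = (qK p 1 • x).coeff := by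
    rw [qK_one, IterLaurent.coeff_polyK_smul]
    apply mulPoly_X_zero_pow_injective k
    rw [mulPoly_comm _ (shiftPoly p), hxk, ← hG.substInner_mulPoly, hGdef, mulPoly_comm,
      hL.substInner_mulPoly, shiftPoly_sub_pow]
  have hq : qK p 1 ≠ 0 := by
    rw [qK_one]
    intro h
    exact hp (shiftPoly_injective (polyK_injective (by rw [h, map_zero, map_zero])))
  have hinv : qInv p 1 * qK p 1 = 1 := inv_mul_cancel₀ (G₀ := K2) hq
  calc fullYE 1 p a b w J T = (qInv p 1 • qK p 1 • x).coeff J T := by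
        rw [IterLaurent.coeff_smul, ← hpx]
        exact finsum_congr fun s => by rw [substInner_eq_substYE]
    _ = x.coeff J T := by
        rw [← IterLaurent.coeff_mul_smul, hinv, IterLaurent.coeff_one_smul]
    _ = _ := by rw [hx]

theorem Fab_add (a b : EW W) (w w' : W) : Fab a b (w + w') = Fab a b w + Fab a b w' := by
  funext m t
  simp [Fab, mf]

theorem Fab_smul (a b : EW W) (r : ℂ) (w : W) : Fab a b (r • w) = r • Fab a b w := by
  funext m t
  simp [Fab, mf]

theorem truncatedRight_Fab (a b : EW W) (w : W) : TruncatedRight (Fab a b w) := by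
  obtain ⟨N, hN⟩ := b.2 w
  refine ⟨-N, fun m t ht => ?_⟩
  have h : mf b w (-t - 1) = 0 := hN _ (by omega)
  rw [Fab, h]
  simp [mf]

theorem mf_YE_eq {a b : EW W} {k : ℕ}
    (hG : ∀ w, IsLaurent2
      (mulPoly ((MvPolynomial.X 0 - MvPolynomial.X 1) ^ k) (Fab a b w)))
    (n : ℤ) (w : W) (m : ℤ) :
    mf (YE a b n) w m = substInner
      (mulPoly ((MvPolynomial.X 0 - MvPolynomial.X 1) ^ k) (Fab a b w)) (-n - 1 + k) (-m - 1) := by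
  have hq : QCPair a b := by
    refine ⟨_, pow_ne_zero k (sub_ne_zero.2 fun h => ?_), hG⟩
    exact absurd (MvPolynomial.X_injective h) (by decide)
  have hraw (w : W) (m : ℤ) : rawYE 1 a b n w m = substInner
      (mulPoly ((MvPolynomial.X 0 - MvPolynomial.X 1) ^ k) (Fab a b w))
      (-n - 1 + k) (-m - 1) := by
    rw [rawYE, dif_pos hq]
    exact fullYE_eq hq.choose_spec.1 (hq.choose_spec.2 w) (hG w) _ _
  let c : EW W :=
    ⟨{ toFun := fun w m => substInner
        (mulPoly ((MvPolynomial.X 0 - MvPolynomial.X 1) ^ k) (Fab a b w)) (-n - 1 + k) (-m - 1)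
       map_add' := fun w w' => by
        funext m
        have h := (hG w).substitutable intBinom
        have h' := (hG w').substitutable intBinom
        rw [Fab_add, ← polyAct_apply, map_add, polyAct_apply, polyAct_apply, substInner,
          substFamily_add h h']
        rfl
       map_smul' := fun r w => by
        funext m
        rw [Fab_smul, ← polyAct_apply, map_smul, polyAct_apply, substInner, substFamily_smul]
        rfl },
      fun w => by
        obtain ⟨N, hN⟩ := (hG w).exists_substInner_eq_zero
        exact ⟨-(N - (-n - 1 + k)), fun m hm => hN _ _ (by omega)⟩⟩
  have hc : ∃ c : EW W, ∀ w m, mf c w m = rawYE ((1 : ℂˣ) : ℂ) a b n w m :=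
    ⟨c, fun w m => by rw [Units.val_one, hraw]; rfl⟩
  rw [YE, YEa, dif_pos hc, hc.choose_spec, Units.val_one, hraw]

end VertexOperation

section Modules

variable {V W : Type*} [AddCommGroup V] [Module ℂ V] [AddCommGroup W] [Module ℂ W]

theorem prodCE_YWf (YW : V →ₗ[ℂ] EW W) (u v : V) (w : W) :
    prodCE (YWf YW) (YWf YW) u v w = substOuter (Fab (YW u) (YW v) w) := by
  funext a b
  refine finsum_congr fun m => ?_
  dsimp only
  by_cases h : a ≤ m
  · rw [if_pos h, intBinom, if_pos (sub_nonneg.2 h), Fab, show b - m + a = b - (m - a) by ring]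
    rfl
  · rw [if_neg h, intBinom_of_neg (by omega), zero_smul]

theorem exists_assocCE_eq_zero (A : NLVA V) (YW : V →ₗ[ℂ] EW W) (u v : V) :
    ∃ k : ℕ, ∀ (w : W) (a b : ℤ), a < -(k : ℤ) → assocCE (Yf A) (YWf YW) u v w a b = 0 := by
  obtain ⟨N, hN⟩ := (A.Y u).2 v
  refine ⟨N.toNat, fun w a b ha => ?_⟩
  have h : mf (A.Y u) v (-a - 1) = 0 := hN _ (by omega)
  rw [assocCE, Yf, h]
  simp [YWf, mf]

end Modules


/-- cf. Proposition 2.15 / `pextra-need-2`.  Let `V` be a nonlocal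
vertex algebra and `W` a vector space with a linear map `Y_W : V → ℰ(W)`,
`Y_W(1,x) = 1_W`.  Then `(W, Y_W)` is a `V`-module if and only if for all
`u, v ∈ V` there is `k ∈ ℕ` with
`(x₁-x₂)^k Y_W(u,x₁) Y_W(v,x₂) ∈ Hom(W, W((x₁,x₂)))` and
`Y_W(Y(u,x₀)v, x) = Y_ℰ(Y_W(u,x), x₀) Y_W(v,x)`. -/
theorem statement9 {V W : Type*} [AddCommGroup V] [Module ℂ V]
    [AddCommGroup W] [Module ℂ W]
    (A : NLVA V) (YW : V →ₗ[ℂ] EW W)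
    (hvac : ∀ (w : W) (n : ℤ), mf (YW A.one) w n = if n = -1 then w else 0) :
    IsModule A YW ↔
      ∀ u v : V, ∃ k : ℕ,
        (∀ w, IsLaurent2 (mulPoly ((MvPolynomial.X 0 - MvPolynomial.X 1) ^ k)
          (Fab (YW u) (YW v) w))) ∧
        ∀ n : ℤ, YW (Yf A u v n) = YE (YW u) (YW v) n := by
  have hX (l : ℕ) (u v : V) (w : W) : (∀ a b : ℤ,
      mulSubPoly (MvPolynomial.X 0 ^ l) (prodCE (YWf YW) (YWf YW) u v w) a b =
        mulSubPoly (MvPolynomial.X 0 ^ l) (assocCE (Yf A) (YWf YW) u v w) a b) ↔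
      mulPoly ((MvPolynomial.X 0 + MvPolynomial.X 1) ^ l)
          (substOuter (Fab (YW u) (YW v) w)) =
        mulPoly ((MvPolynomial.X 0 + MvPolynomial.X 1) ^ l)
          (assocCE (Yf A) (YWf YW) u v w) := by
    simp only [mulSubPoly_X_zero_pow, prodCE_YWf, funext_iff]
  simp only [IsModule, hX]
  constructor
  · rintro ⟨-, h⟩ u v
    obtain ⟨k, hk⟩ := exists_assocCE_eq_zero A YW u v
    have key (w : W) := (h u v w).elim fun l hl =>
      isLaurent2_and_substInner_eq (truncatedRight_Fab (YW u) (YW v) w) (hk w) hl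
    refine ⟨k, fun w => (key w).1, fun n => ?_⟩
    refine Subtype.ext (LinearMap.ext fun w => funext fun m => ?_)
    refine Eq.trans ?_ (mf_YE_eq (fun w => (key w).1) n w m).symm
    rw [(key w).2, mulPoly_X_zero_pow]
    simp [assocCE, YWf, mf]
  · refine fun h => ⟨hvac, fun u v w => ?_⟩
    obtain ⟨k, hL, hk⟩ := h u v
    refine exists_mulPoly_substOuter_eq (truncatedRight_Fab _ _ w) (hL w) ?_
    funext a b
    have h1 := mf_YE_eq hL (k - a - 1) w (-b - 1)
    rw [← hk, show -(k - a - 1) - 1 + (k : ℤ) = a by ring, show -(-b - 1) - 1 = b by ring] at h1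
    rw [← h1, mulPoly_X_zero_pow]
    simp only [assocCE, YWf]
    rw [show -(a - (k : ℤ)) - 1 = k - a - 1 by ring]

end NVA
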